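/- Let I be a real interval of length at least (ε/(φU' − φL')²)^{1/3}, where ε > 0 and φL' < φU' are real numbers. Let φ₁, φ₂ : I → ℝ be differentiable functions with φL' ≤ φᵢ'(x) ≤ φU' for all x ∈ I and i = 1, 2. If ∫_I (φ₁(x) − φ₂(x))² dx ≤ ε, then sup_{x ∈ I} |φ₁(x) − φ₂(x)| ≤ (8ε(φU' − φL'))^{1/3}. -/

import Mathlib

open MeasureTheory Set

/-- If `φ₁, φ₂` are differentiable on the interval `[a, b]` with derivatives bounded
between `φL'` and `φU'`, the interval has length at least `(ε/(φU' − φL')²)^{1/3}`,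
and `∫_a^b (φ₁ − φ₂)² ≤ ε`, then `sup_{x ∈ [a,b]} |φ₁(x) − φ₂(x)| ≤ (8ε(φU' − φL'))^{1/3}`. -/
theorem stmt3 (a b ε φL' φU' : ℝ) (hε : 0 < ε) (hLU : φL' < φU')
    (hlen : (ε / (φU' - φL') ^ 2) ^ ((1 : ℝ) / 3) ≤ b - a)
    (φ₁ φ₂ d₁ d₂ : ℝ → ℝ)
    (hd₁ : ∀ x ∈ Icc a b, HasDerivAt φ₁ (d₁ x) x)
    (hd₂ : ∀ x ∈ Icc a b, HasDerivAt φ₂ (d₂ x) x)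
    (hb₁ : ∀ x ∈ Icc a b, φL' ≤ d₁ x ∧ d₁ x ≤ φU')
    (hb₂ : ∀ x ∈ Icc a b, φL' ≤ d₂ x ∧ d₂ x ≤ φU')
    (hint : (∫ x in a..b, (φ₁ x - φ₂ x) ^ 2) ≤ ε) :
    ∀ x ∈ Icc a b, |φ₁ x - φ₂ x| ≤ (8 * ε * (φU' - φL')) ^ ((1 : ℝ) / 3) := by
  intro x hx
  by_contra! hM
  obtain ⟨K, hK⟩ : ∃ K, K = φU' - φL' := ⟨_, rfl⟩
  have hK0 : 0 < K := by linarith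
  rw [← hK] at hlen hM
  obtain ⟨l, hl⟩ : ∃ l, l = (ε / K ^ 2) ^ ((1 : ℝ) / 3) := ⟨_, rfl⟩
  have hl0 : 0 < l := by rw [hl]; positivity
  have hl3 : l ^ 3 = ε / K ^ 2 := by
    rw [hl, ← Real.rpow_natCast, ← Real.rpow_mul (by positivity)]
    norm_num
  have hε' : ε = K ^ 2 * l ^ 3 := by rw [hl3]; field_simp
  have hT : (8 * ε * K) ^ ((1 : ℝ) / 3) = 2 * (K * l) := by
    have : 8 * ε * K = (2 * (K * l)) ^ (3 : ℝ) := by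
      rw [show (3 : ℝ) = ((3 : ℕ) : ℝ) by norm_num, Real.rpow_natCast, hε']; ring
    rw [this, ← Real.rpow_mul (by positivity)]
    norm_num
  rw [hT] at hM
  rw [← hl] at hlen
  obtain ⟨u, hau, hub, hux, hxu⟩ : ∃ u, a ≤ u ∧ u + l ≤ b ∧ u ≤ x ∧ x ≤ u + l := by
    rcases le_total a (x - l) with h | h
    · exact ⟨x - l, h, by linarith [hx.2], by linarith, by linarith⟩
    · exact ⟨a, le_rfl, by linarith, hx.1, by linarith⟩
  have hlip : ∀ y ∈ Icc a b, |(φ₁ y - φ₂ y) - (φ₁ x - φ₂ x)| ≤ K * |y - x| := by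
    intro y hy
    have := (convex_Icc a b).norm_image_sub_le_of_norm_hasDerivWithin_le
      (f := fun z => φ₁ z - φ₂ z) (f' := fun z => d₁ z - d₂ z) (C := K)
      (fun z hz => ((hd₁ z hz).sub (hd₂ z hz)).hasDerivWithinAt)
      (fun z hz => by
        rw [Real.norm_eq_abs, abs_le]
        have h1 := hb₁ z hz
        have h2 := hb₂ z hz
        constructor <;> linarith [h1.1, h1.2, h2.1, h2.2]) hx hy
    simpa [Real.norm_eq_abs] using this
  obtain ⟨m, hm⟩ : ∃ m, m = |φ₁ x - φ₂ x| - K * l := ⟨_, rfl⟩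
  have hmc : K * l < m := by linarith
  have hKl : 0 < K * l := by positivity
  have hlow : ∀ y ∈ Icc u (u + l), m ^ 2 ≤ (φ₁ y - φ₂ y) ^ 2 := by
    intro y hy
    have h1 := hlip y ⟨by linarith [hy.1], by linarith [hy.2]⟩
    have h2 : |y - x| ≤ l := by
      rw [abs_le]; constructor <;> linarith [hy.1, hy.2]
    have h3 : K * |y - x| ≤ K * l := by gcongr
    have h4 := abs_sub_abs_le_abs_sub (φ₁ x - φ₂ x) (φ₁ y - φ₂ y)
    rw [abs_sub_comm (φ₁ x - φ₂ x) (φ₁ y - φ₂ y)] at h4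
    have h5 : m ≤ |φ₁ y - φ₂ y| := by linarith
    rw [← sq_abs (φ₁ y - φ₂ y)]
    have : 0 ≤ m := by linarith
    gcongr
  have hcont : ContinuousOn (fun y => (φ₁ y - φ₂ y) ^ 2) (Icc a b) := fun z hz =>
    (((hd₁ z hz).continuousAt.sub (hd₂ z hz).continuousAt).pow 2).continuousWithinAt
  have hab : a ≤ b := by linarith
  have hul : u ≤ u + l := by linarith
  have hi : IntervalIntegrable (fun y => (φ₁ y - φ₂ y) ^ 2) volume a b :=
    ContinuousOn.intervalIntegrable_of_Icc hab hcont
  have hi2 : IntervalIntegrable (fun y => (φ₁ y - φ₂ y) ^ 2) volume u (u + l) :=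
    ContinuousOn.intervalIntegrable_of_Icc hul (hcont.mono (Icc_subset_Icc hau hub))
  have hA : (∫ y in u..(u + l), (φ₁ y - φ₂ y) ^ 2) ≤ ∫ y in a..b, (φ₁ y - φ₂ y) ^ 2 :=
    intervalIntegral.integral_mono_interval hau hul hub
      (Filter.Eventually.of_forall fun y => sq_nonneg _) hi
  have hB : (∫ _ in u..(u + l), m ^ 2) ≤ ∫ y in u..(u + l), (φ₁ y - φ₂ y) ^ 2 :=
    intervalIntegral.integral_mono_on hul (by simp) hi2 hlow
  rw [intervalIntegral.integral_const, smul_eq_mul, add_sub_cancel_left] at hB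
  have hC : (K * l) ^ 2 * l < m ^ 2 * l := by gcongr
  nlinarith
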